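/- arXiv:1205.2948 — 2 statements merged into one kernel-verified Lean document; each statement's English description precedes it below -/
import Mathlib

section
/- Assume the non-degeneracy condition P(a_1 ≤ r, b_1 ≤ r) + P(a_1 > r, b_1 > r) ≠ 0. Then for every n ∈ ℤ the random variable α_n = Σ_{j=0}^∞ (∏_{s=0}^{j−1} W_{n−sd}) U_{n−jd} takes only the values 0 and 1 almost surely; equivalently, α_n = 1(α_n = 1) a.s. -/
open MeasureTheory ProbabilityTheory Filter Finset

/-- Grouping a family of independent random variables indexed by a sigma type into blocks gives
independent random vectors. -/
lemma iIndepFun_curry {ι Ω : Type*} {mΩ : MeasurableSpace Ω} {P : Measure Ω} {κ : ι → Type*}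
    {𝓧 : (i : ι) → κ i → Type*} {m𝓧 : ∀ i j, MeasurableSpace (𝓧 i j)}
    {X : (i : ι) → (j : κ i) → Ω → 𝓧 i j} (mX : ∀ i j, Measurable (X i j))
    (h : iIndepFun (fun (p : (i : ι) × κ i) ω ↦ X p.1 p.2 ω) P) :
    iIndepFun (fun i ω ↦ (X i · ω)) P := by
  have := h.isProbabilityMeasure
  have : ∀ i j, IsProbabilityMeasure (P.map (X i j)) :=
    fun i j ↦ Measure.isProbabilityMeasure_map (mX i j).aemeasurable
  have hblock (i : ι) : iIndepFun (X i) P :=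
    h.precomp (g := fun j : κ i ↦ (⟨i, j⟩ : (i : ι) × κ i)) sigma_mk_injective
  rw [iIndepFun_iff_map_fun_eq_infinitePi_map (by fun_prop)]
  have hcurry : (MeasurableEquiv.piCurry 𝓧) ∘ (fun ω p ↦ X p.1 p.2 ω) = fun ω i j ↦ X i j ω := by
    ext; simp [Sigma.curry]
  have hinner (i : ι) : P.map (fun ω ↦ (X i · ω)) = Measure.infinitePi fun j ↦ P.map (X i j) :=
    (iIndepFun_iff_map_fun_eq_infinitePi_map (mX i)).1 (hblock i)
  simp_rw [hinner]
  rw [← hcurry, ← Measure.map_map (by fun_prop) (by fun_prop),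
    (iIndepFun_iff_map_fun_eq_infinitePi_map (by fun_prop)).1 h,
    Measure.infinitePi_map_piCurry (fun i j ↦ P.map (X i j))]

/-- Independent events of a common positive probability almost surely do not all fail. -/
lemma ae_exists_mem_of_iIndepSet {Ω : Type*} {mΩ : MeasurableSpace Ω} {P : Measure Ω}
    {s : ℕ → Set Ω} (hsm : ∀ k, MeasurableSet (s k)) (hs : iIndepSet s P)
    {c : ENNReal} (hc : c ≠ 0) (hsc : ∀ k, P (s k) = c) :
    ∀ᵐ ω ∂P, ∃ k, ω ∈ s k := by
  have := hs.isProbabilityMeasure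
  have hlim : P (limsup s atTop) = 1 :=
    measure_limsup_eq_one hsm hs (by simp_rw [hsc]; exact ENNReal.tsum_const_eq_top_of_ne_zero hc)
  have hmem : ∀ᵐ ω ∂P, ω ∈ limsup s atTop :=
    (prob_compl_eq_zero_iff (MeasurableSet.measurableSet_limsup hsm)).2 hlim
  filter_upwards [hmem] with ω hω
  exact (mem_limsup_iff_frequently_mem.1 hω).exists

/-- In an i.i.d. sequence, a non-null event about a window of `q + 1` consecutive terms
occurs almost surely along any backward arithmetic progression of window positions. -/
lemma ae_exists_window_mem {Ω : Type*} {mΩ : MeasurableSpace Ω} {P : Measure Ω}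
    {e : ℤ → Ω → ℝ} (he : ∀ n, Measurable (e n)) (hindep : iIndepFun e P)
    (hident : ∀ n, P.map (e n) = P.map (e 0)) (q : ℕ) {d : ℕ} (hd : 0 < d)
    {S : Set (Fin (q + 1) → ℝ)} (hS : MeasurableSet S) (m : ℤ)
    (hpos : P {ω | (fun i : Fin (q + 1) ↦ e (m - (i : ℕ)) ω) ∈ S} ≠ 0) (n : ℤ) :
    ∀ᵐ ω ∂P, ∃ k : ℕ, (fun i : Fin (q + 1) ↦ e (n - (k : ℤ) * d - (i : ℕ)) ω) ∈ S := by
  have hmeas (l : ℤ) : Measurable fun ω ↦ fun i : Fin (q + 1) ↦ e (l - (i : ℕ)) ω :=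
    measurable_pi_lambda _ fun i ↦ he _
  have hlaw (l : ℤ) : P.map (fun ω ↦ fun i : Fin (q + 1) ↦ e (l - (i : ℕ)) ω) =
      Measure.pi fun _ ↦ P.map (e 0) := by
    have hinj : Function.Injective fun i : Fin (q + 1) ↦ l - ((i : ℕ) : ℤ) := by
      intro i j hij
      ext
      simpa using hij
    rw [(hindep.precomp hinj).map_fun_eq_pi_map fun i ↦ (he _).aemeasurable]
    simp_rw [hident]
  have hprob (l : ℤ) : P {ω | (fun i : Fin (q + 1) ↦ e (l - (i : ℕ)) ω) ∈ S} =
      Measure.pi (fun _ ↦ P.map (e 0)) S := by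
    rw [← hlaw l, Measure.map_apply (hmeas l) hS]
    rfl
  have hinj : Function.Injective fun p : (_ : ℕ) × Fin (q + 1) ↦
      n - ((p.1 * (q + 1) : ℕ) : ℤ) * d - ((p.2 : ℕ) : ℤ) := by
    rintro ⟨k, i⟩ ⟨l, j⟩ h
    have hsum : (i : ℕ) + (q + 1) * (k * d) = j + (q + 1) * (l * d) := by
      zify
      push_cast at h
      linarith
    have hij := congrArg (· % (q + 1)) hsum
    simp only [Nat.add_mul_mod_self_left, Nat.mod_eq_of_lt i.isLt, Nat.mod_eq_of_lt j.isLt] at hij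
    obtain rfl : i = j := Fin.ext hij
    have hkl : k = l := by simpa [hd.ne'] using hsum
    subst hkl
    rfl
  have hblocks := iIndepFun_curry (κ := fun _ : ℕ ↦ Fin (q + 1))
    (X := fun k i ↦ e (n - ((k * (q + 1) : ℕ) : ℤ) * d - ((i : ℕ) : ℤ)))
    (fun k i ↦ he _) (hindep.precomp hinj)
  have hsets : iIndepSet (fun k : ℕ ↦
      {ω | (fun i : Fin (q + 1) ↦ e (n - ((k * (q + 1) : ℕ) : ℤ) * d - (i : ℕ)) ω) ∈ S}) P :=
    (iIndepSet_iff_meas_biInter fun k ↦ hmeas _ hS).2 fun s ↦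
      hblocks.measure_inter_preimage_eq_mul s (sets := fun _ ↦ S) fun _ _ ↦ hS
  filter_upwards [ae_exists_mem_of_iIndepSet (fun k ↦ hmeas _ hS) hsets (hprob m ▸ hpos)
    fun k ↦ hprob _] with ω ⟨k, hk⟩
  exact ⟨k * (q + 1), hk⟩

/-- The backward expansion of the recursion `x n = U n + W n * x (n - d)` takes values in `{0, 1}`
as soon as some coefficient vanishes, provided that `U` and `U + W` are `{0, 1}`-valued. -/
lemma tsum_prod_mul_eq_zero_or_one {U W : ℤ → ℝ} (d : ℤ)
    (hU : ∀ n, U n = 0 ∨ U n = 1) (hUW : ∀ n, U n + W n = 0 ∨ U n + W n = 1)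
    (k : ℕ) (n : ℤ) (hk : W (n - (k : ℤ) * d) = 0) :
    (∑' j : ℕ, (∏ s ∈ Finset.range j, W (n - (s : ℤ) * d)) * U (n - (j : ℤ) * d) = 0) ∨
      (∑' j : ℕ, (∏ s ∈ Finset.range j, W (n - (s : ℤ) * d)) * U (n - (j : ℤ) * d) = 1) := by
  have hrec (n : ℤ) (k : ℕ) (hk : W (n - (k : ℤ) * d) = 0) :
      ∑' j : ℕ, (∏ s ∈ Finset.range j, W (n - (s : ℤ) * d)) * U (n - (j : ℤ) * d) =
        U n + W n * ∑' j : ℕ, (∏ s ∈ Finset.range j, W (n - d - (s : ℤ) * d)) *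
          U (n - d - (j : ℤ) * d) := by
    have hsumm : Summable fun j : ℕ ↦
        (∏ s ∈ Finset.range j, W (n - (s : ℤ) * d)) * U (n - (j : ℤ) * d) := by
      refine summable_of_ne_finset_zero (s := Finset.range (k + 1)) fun j hj ↦ ?_
      rw [Finset.prod_eq_zero (i := k) (by simp at hj ⊢; omega) hk, zero_mul]
    rw [hsumm.tsum_eq_zero_add, ← tsum_mul_left]
    have hshift (j : ℕ) : n - ((j + 1 : ℕ) : ℤ) * d = n - d - (j : ℤ) * d := by
      push_cast
      ring
    simp only [Finset.prod_range_succ', hshift]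
    simp [mul_left_comm, mul_comm]
  induction k generalizing n with
  | zero =>
    rw [hrec n 0 hk]
    have hW : W n = 0 := by simpa using hk
    simpa [hW] using hU n
  | succ k ih =>
    have hprev := ih (n - d) (by rw [← hk]; congr 1; push_cast; ring)
    rw [hrec n (k + 1) hk]
    rcases hprev with h | h <;> rw [h]
    · simpa using hU n
    · simpa using hUW n

/-- Under the non-degeneracy condition, for every `n ∈ ℤ` the random
variable `α_n = Σ_{j=0}^∞ (∏_{s=0}^{j−1} W_{n−sd}) U_{n−jd}` takes only the values
`0` and `1` almost surely; equivalently, `α_n = 1(α_n = 1)` a.s. -/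
theorem tma_alpha_zero_one
    {Ω : Type*} [MeasureSpace Ω] [IsProbabilityMeasure (ℙ : Measure Ω)]
    (e : ℤ → Ω → ℝ)
    (he : ∀ n, Measurable (e n))
    (hindep : iIndepFun e ℙ)
    (hident : ∀ n, Measure.map (e n) ℙ = Measure.map (e 0) ℙ)
    (q d : ℕ) (hq : 0 < q) (hd : 0 < d)
    (r μ1 μ2 : ℝ) (φ ψ : ℕ → ℝ)
    (a b U W : ℤ → Ω → ℝ)
    (ha : ∀ n ω, a n ω = μ2 + e n ω + ∑ i ∈ Finset.Icc 1 q, ψ i * e (n - i) ω)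
    (hb : ∀ n ω, b n ω = μ1 + e n ω + ∑ i ∈ Finset.Icc 1 q, φ i * e (n - i) ω)
    (hU : ∀ n ω, U n ω = if a n ω ≤ r then 1 else 0)
    (hW : ∀ n ω, W n ω = (if b n ω ≤ r then 1 else 0) - (if a n ω ≤ r then 1 else 0))
    (hnd : ℙ {ω | a 1 ω ≤ r ∧ b 1 ω ≤ r} + ℙ {ω | r < a 1 ω ∧ r < b 1 ω} ≠ 0)
    (α : ℤ → Ω → ℝ)
    (hα : ∀ n ω, α n ω =
      ∑' j : ℕ, (∏ s ∈ Finset.range j, W (n - (s : ℤ) * d) ω) * U (n - (j : ℤ) * d) ω) :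
    ∀ n : ℤ,
      (∀ᵐ ω ∂ℙ, α n ω = 0 ∨ α n ω = 1) ∧
      (∀ᵐ ω ∂ℙ, α n ω = if α n ω = 1 then 1 else 0) := by
  intro n
  have hzero : ∀ᵐ ω ∂ℙ, ∃ k : ℕ, W (n - (k : ℤ) * d) ω = 0 := by
    let ma (c : ℝ) (θ : ℕ → ℝ) (v : Fin (q + 1) → ℝ) : ℝ :=
      c + v 0 + ∑ i ∈ Finset.Icc 1 q, θ i * v (Fin.ofNat (q + 1) i)
    have hma (c : ℝ) (θ : ℕ → ℝ) : Measurable (ma c θ) := by fun_prop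
    have hma_window (c : ℝ) (θ : ℕ → ℝ) (m : ℤ) (ω : Ω) :
        ma c θ (fun i : Fin (q + 1) ↦ e (m - (i : ℕ)) ω) =
          c + e m ω + ∑ i ∈ Finset.Icc 1 q, θ i * e (m - i) ω := by
      have hsum : ∑ i ∈ Finset.Icc 1 q, θ i * e (m - (Fin.ofNat (q + 1) i : ℕ)) ω =
          ∑ i ∈ Finset.Icc 1 q, θ i * e (m - i) ω := by
        refine Finset.sum_congr rfl fun i hi ↦ ?_
        rw [Fin.val_ofNat, Nat.mod_eq_of_lt (Nat.lt_succ_of_le (Finset.mem_Icc.1 hi).2)]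
      simp only [ma, hsum]
      simp
    let S : Set (Fin (q + 1) → ℝ) := {v | ma μ2 ψ v ≤ r ↔ ma μ1 φ v ≤ r}
    have hS : MeasurableSet S :=
      (measurableSet_le (hma _ _) measurable_const).iff (measurableSet_le (hma _ _) measurable_const)
    have hmem (m : ℤ) (ω : Ω) :
        (fun i : Fin (q + 1) ↦ e (m - (i : ℕ)) ω) ∈ S ↔ (a m ω ≤ r ↔ b m ω ≤ r) := by
      simp only [S, Set.mem_ofPred_eq, hma_window, ← ha, ← hb]
    have hpos : ℙ {ω | (fun i : Fin (q + 1) ↦ e (1 - (i : ℕ)) ω) ∈ S} ≠ 0 := by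
      simp only [hmem]
      contrapose! hnd
      rw [add_eq_zero]
      constructor <;> refine measure_mono_null (fun ω hω ↦ ?_) hnd
      · exact iff_of_true hω.1 hω.2
      · exact iff_of_false hω.1.not_ge hω.2.not_ge
    filter_upwards [ae_exists_window_mem he hindep hident q hd hS 1 hpos n] with ω ⟨k, hk⟩
    exact ⟨k, by simp [hW, (hmem _ ω).1 hk]⟩
  have h01 : ∀ᵐ ω ∂ℙ, α n ω = 0 ∨ α n ω = 1 := by
    filter_upwards [hzero] with ω ⟨k, hk⟩
    rw [hα]
    refine tsum_prod_mul_eq_zero_or_one (U := (U · ω)) (W := (W · ω)) d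
      (fun m ↦ ?_) (fun m ↦ ?_) k n hk
    · rw [hU]
      split_ifs <;> simp
    · rw [hU, hW]
      split_ifs <;> simp
  refine ⟨h01, ?_⟩
  filter_upwards [h01] with ω hω
  rcases hω with h | h <;> simp [h]
end

section
/- Assume the non-degeneracy condition P(a_1 ≤ r, b_1 ≤ r) + P(a_1 > r, b_1 > r) ≠ 0. If {ỹ_n : n ∈ ℤ} is any process satisfying, for every n, almost surely ỹ_n = b_n when ỹ_{n−d} ≤ r and ỹ_n = a_n when ỹ_{n−d} > r, then for every n, ỹ_n = a_n + (b_n − a_n)·α_{n−d} almost surely; in particular the strictly stationary solution of the TMA(q) model is unique. -/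
open MeasureTheory ProbabilityTheory Filter Finset

/-- Independent variables indexed by a product remain independent when grouped into rows. -/
lemma ProbabilityTheory.iIndepFun.curry {Ω ι κ 𝓧 : Type*} {mΩ : MeasurableSpace Ω}
    {m𝓧 : MeasurableSpace 𝓧} {P : Measure Ω} {X : ι × κ → Ω → 𝓧}
    (hX : iIndepFun X P) (mX : ∀ p, Measurable (X p)) :
    iIndepFun (fun i ω j ↦ X (i, j) ω) P := by
  have := hX.isProbabilityMeasure
  have hprob : ∀ i j, IsProbabilityMeasure (P.map (X (i, j))) :=
    fun i j ↦ Measure.isProbabilityMeasure_map (mX (i, j)).aemeasurable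
  have hrow (i : ι) : P.map (fun ω j ↦ X (i, j) ω)
      = Measure.infinitePi fun j ↦ P.map (X (i, j)) :=
    (hX.precomp (Prod.mk_right_injective i)).map_fun_eq_infinitePi_map fun j ↦ mX (i, j)
  rw [iIndepFun_iff_map_fun_eq_infinitePi_map (by fun_prop)]
  simp_rw [hrow]
  rw [← Measure.infinitePi_map_curry (fun i j ↦ P.map (X (i, j))),
    ← hX.map_fun_eq_infinitePi_map mX, Measure.map_map (by fun_prop) (by fun_prop)]
  rfl

/-- If a block of `p` consecutive values of an i.i.d. sequence lies in `S` with positive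
probability, then almost surely some block among those ending at `n - k * N`, `k : ℕ`,
lies in `S`, provided these blocks do not overlap. -/
lemma ae_exists_block_mem {Ω E : Type*} {mΩ : MeasurableSpace Ω} {mE : MeasurableSpace E}
    {P : Measure Ω} {e : ℤ → Ω → E} (he : ∀ n, Measurable (e n)) (hindep : iIndepFun e P)
    (hident : ∀ n, P.map (e n) = P.map (e 0)) {p N : ℕ} (hpN : p ≤ N)
    {S : Set (Fin p → E)} (hS : MeasurableSet S) {m : ℤ}
    (hpos : P {ω | (fun i : Fin p ↦ e (m - (i : ℕ)) ω) ∈ S} ≠ 0) (n : ℤ) :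
    ∀ᵐ ω ∂P, ∃ k : ℕ, (fun i : Fin p ↦ e (n - (k : ℤ) * N - (i : ℕ)) ω) ∈ S := by
  have := hindep.isProbabilityMeasure
  have hlaw (l : ℤ) : P {ω | (fun i : Fin p ↦ e (l - (i : ℕ)) ω) ∈ S}
      = Measure.pi (fun _ : Fin p ↦ P.map (e 0)) S := by
    have hinj : Function.Injective fun i : Fin p ↦ l - ((i : ℕ) : ℤ) := fun i j hij ↦ by
      ext
      simpa using hij
    have h := (hindep.precomp hinj).map_fun_eq_pi_map fun i ↦ (he _).aemeasurable
    simp_rw [hident] at h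
    rw [← h, Measure.map_apply (measurable_pi_lambda _ fun i ↦ he _) hS]
    rfl
  have hinj : Function.Injective
      fun x : ℕ × Fin p ↦ n - (x.1 : ℤ) * N - ((x.2 : ℕ) : ℤ) := by
    rintro ⟨k, i⟩ ⟨k', i'⟩ h
    have h' : (i : ℕ) + N * k = i' + N * k' := by
      zify
      simp only at h
      linarith
    have hi := i.2.trans_le hpN
    have hi' := i'.2.trans_le hpN
    have hN : 0 < N := by omega
    have hk := congrArg (· / N) h'
    have hm := congrArg (· % N) h'
    simp only [Nat.add_mul_div_left _ _ hN, Nat.div_eq_of_lt hi, Nat.div_eq_of_lt hi',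
      zero_add] at hk
    simp only [Nat.add_mul_mod_self_left, Nat.mod_eq_of_lt hi, Nat.mod_eq_of_lt hi'] at hm
    exact Prod.ext hk (Fin.ext hm)
  have hblock := (hindep.precomp hinj).curry fun x ↦ he _
  let s : ℕ → Set Ω := fun k ↦ {ω | (fun i : Fin p ↦ e (n - (k : ℤ) * N - (i : ℕ)) ω) ∈ S}
  have hs (k : ℕ) : MeasurableSet (s k) := measurable_pi_lambda _ (fun i ↦ he _) hS
  have hsind : iIndepSet s P := by
    rw [iIndepSet_iff_meas_biInter hs]
    exact fun t ↦ hblock.measure_inter_preimage_eq_mul t fun _ _ ↦ hS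
  have hsum : ∑' k, P (s k) = ⊤ := by
    simp_rw [s, hlaw, ← hlaw m]
    exact ENNReal.tsum_const_eq_top_of_ne_zero hpos
  have hlim : ∀ᵐ ω ∂P, ω ∈ limsup s atTop :=
    (mem_ae_iff_prob_eq_one (.measurableSet_limsup hs)).2 (measure_limsup_eq_one hs hsind hsum)
  filter_upwards [hlim] with ω hω
  exact (mem_limsup_iff_frequently_mem.1 hω).exists

/-- A solution of the backward recursion `v j = u j + w j * v (j + 1)` is given by its series
expansion as soon as one of the multipliers vanishes. -/
lemma eq_tsum_of_affine_recursion {R : Type*} [CommRing R] [TopologicalSpace R] {u v w : ℕ → R}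
    (hv : ∀ j, v j = u j + w j * v (j + 1)) {k : ℕ} (hk : w k = 0) :
    v 0 = ∑' j, (∏ s ∈ Finset.range j, w s) * u j := by
  have key (K : ℕ) : v 0 = ∑ j ∈ Finset.range K, (∏ s ∈ Finset.range j, w s) * u j
      + (∏ s ∈ Finset.range K, w s) * v K := by
    induction K with
    | zero => simp
    | succ K ih =>
      rw [ih, Finset.sum_range_succ, Finset.prod_range_succ, hv K]
      ring
  have hzero {K : ℕ} (hK : k < K) : ∏ s ∈ Finset.range K, w s = 0 :=
    Finset.prod_eq_zero (Finset.mem_range.2 hK) hk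
  rw [key (k + 1), hzero k.lt_succ_self, zero_mul, add_zero, tsum_eq_sum]
  intro j hj
  rw [hzero (by simpa using hj), zero_mul]

/-- A finite moving average written as a function of the block of its innovations. -/
lemma moving_average_eq_block (f : ℤ → ℝ) (c : ℕ → ℝ) (μ : ℝ) (q : ℕ) (n : ℤ) :
    μ + f n + ∑ i ∈ Finset.Icc 1 q, c i * f (n - i)
      = μ + f (n - ((0 : Fin (q + 1)) : ℕ))
        + ∑ j : Fin q, c (j + 1) * f (n - ((j.succ : Fin (q + 1)) : ℕ)) := by
  have h : Finset.Icc 1 q = Finset.Ico (0 + 1) (q + 1) := by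
    ext
    simp
  rw [h, ← Finset.sum_Ico_add' (fun i : ℕ ↦ c i * f (n - i)), ← Finset.range_eq_Ico,
    Finset.sum_range]
  simp

/-- Under the non-degeneracy condition, if `{ỹ_n}` is any process
satisfying, for every `n`, almost surely `ỹ_n = b_n` when `ỹ_{n−d} ≤ r` and
`ỹ_n = a_n` when `ỹ_{n−d} > r`, then for every `n`,
`ỹ_n = a_n + (b_n − a_n)·α_{n−d}` almost surely; in particular the strictly
stationary solution of the TMA(q) model is unique. -/
theorem tma_solution_unique
    {Ω : Type*} [MeasureSpace Ω] [IsProbabilityMeasure (ℙ : Measure Ω)]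
    (e : ℤ → Ω → ℝ)
    (he : ∀ n, Measurable (e n))
    (hindep : iIndepFun e ℙ)
    (hident : ∀ n, Measure.map (e n) ℙ = Measure.map (e 0) ℙ)
    (q d : ℕ) (hq : 0 < q) (hd : 0 < d)
    (r μ1 μ2 : ℝ) (φ ψ : ℕ → ℝ)
    (a b U W : ℤ → Ω → ℝ)
    (ha : ∀ n ω, a n ω = μ2 + e n ω + ∑ i ∈ Finset.Icc 1 q, ψ i * e (n - i) ω)
    (hb : ∀ n ω, b n ω = μ1 + e n ω + ∑ i ∈ Finset.Icc 1 q, φ i * e (n - i) ω)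
    (hU : ∀ n ω, U n ω = if a n ω ≤ r then 1 else 0)
    (hW : ∀ n ω, W n ω = (if b n ω ≤ r then 1 else 0) - (if a n ω ≤ r then 1 else 0))
    (hnd : ℙ {ω | a 1 ω ≤ r ∧ b 1 ω ≤ r} + ℙ {ω | r < a 1 ω ∧ r < b 1 ω} ≠ 0)
    (α : ℤ → Ω → ℝ)
    (hα : ∀ n ω, α n ω =
      ∑' j : ℕ, (∏ s ∈ Finset.range j, W (n - (s : ℤ) * d) ω) * U (n - (j : ℤ) * d) ω)
    (ytil : ℤ → Ω → ℝ)
    (hytil_meas : ∀ n, Measurable (ytil n))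
    (hytil : ∀ n : ℤ, ∀ᵐ ω ∂ℙ,
      (ytil (n - d) ω ≤ r → ytil n ω = b n ω) ∧
      (r < ytil (n - d) ω → ytil n ω = a n ω)) :
    ∀ n : ℤ, ∀ᵐ ω ∂ℙ,
      ytil n ω = a n ω + (b n ω - a n ω) * α (n - d) ω := by
  let F : ℝ → (ℕ → ℝ) → (Fin (q + 1) → ℝ) → ℝ :=
    fun μ c x ↦ μ + x 0 + ∑ j : Fin q, c (j + 1) * x j.succ
  have hF (μ : ℝ) (c : ℕ → ℝ) : Measurable (F μ c) := by fun_prop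
  have haF (n : ℤ) (ω : Ω) : a n ω = F μ2 ψ fun i ↦ e (n - (i : ℕ)) ω := by
    rw [ha, moving_average_eq_block (fun n ↦ e n ω)]
  have hbF (n : ℤ) (ω : Ω) : b n ω = F μ1 φ fun i ↦ e (n - (i : ℕ)) ω := by
    rw [hb, moving_average_eq_block (fun n ↦ e n ω)]
  let S : Set (Fin (q + 1) → ℝ) := {x | F μ2 ψ x ≤ r ↔ F μ1 φ x ≤ r}
  have hS : MeasurableSet S :=
    (measurableSet_le (hF μ2 ψ) measurable_const).iff (measurableSet_le (hF μ1 φ) measurable_const)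
  have hmemS (n : ℤ) (ω : Ω) :
      (fun i : Fin (q + 1) ↦ e (n - (i : ℕ)) ω) ∈ S ↔ (a n ω ≤ r ↔ b n ω ≤ r) := by
    rw [haF, hbF]
    rfl
  have hpos : ℙ {ω | (fun i : Fin (q + 1) ↦ e (1 - (i : ℕ)) ω) ∈ S} ≠ 0 := by
    simp_rw [hmemS]
    refine fun h ↦ hnd ?_
    rw [measure_mono_null (fun ω hω ↦ iff_of_true hω.1 hω.2) h,
      measure_mono_null (fun ω hω ↦ iff_of_false (not_le.2 hω.1) (not_le.2 hω.2)) h, add_zero]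
  have hN : q + 1 ≤ (q + 1) * d := Nat.le_mul_of_pos_right _ hd
  intro n
  filter_upwards [ae_exists_block_mem he hindep hident hN hS hpos (n - d), ae_all_iff.2 hytil]
    with ω ⟨k, hk⟩ hy
  let V : ℤ → ℝ := fun m ↦ if ytil m ω ≤ r then 1 else 0
  have hyV (m : ℤ) : ytil m ω = a m ω + (b m ω - a m ω) * V (m - d) := by
    by_cases h : ytil (m - d) ω ≤ r
    · simp [V, h, (hy m).1 h]
    · simp [V, h, (hy m).2 (not_le.1 h)]
  have hV (m : ℤ) : V m = U m ω + W m ω * V (m - d) := by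
    rw [hU, hW]
    by_cases h : ytil (m - d) ω ≤ r
    · simp [V, h, (hy m).1 h]
    · simp [V, h, (hy m).2 (not_le.1 h)]
  have hWk : W (n - d - ((k * (q + 1) : ℕ) : ℤ) * d) ω = 0 := by
    rw [hmemS] at hk
    push_cast at hk ⊢
    rw [← mul_assoc] at hk
    simp [hW, hk]
  have hrec (j : ℕ) : V (n - d - (j : ℤ) * d) = U (n - d - (j : ℤ) * d) ω
      + W (n - d - (j : ℤ) * d) ω * V (n - d - ((j + 1 : ℕ) : ℤ) * d) := by
    rw [hV]
    congr 3
    push_cast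
    ring
  have hα' : V (n - d) = α (n - d) ω := by
    rw [hα, ← eq_tsum_of_affine_recursion hrec hWk]
    simp
  rw [hyV, hα']
end
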